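/- Let d ≥ 2 and let f be an nc self-map of 𝔅_d whose fixed-point set at level 1 is exactly the disc {(z,0,…,0) : z ∈ ℂ, |z| < 1} ⊆ 𝔅_d(1). Then every fixed point of f₂ in 𝔅_d(2) has the form (Z_1, 0, …, 0), i.e., its coordinates with index 2,…,d all vanish. -/

import Mathlib

open Matrix
open scoped ComplexOrder

attribute [local instance] Matrix.normedAddCommGroup Matrix.normedSpace

/-- The space of `d`-tuples of `n × n` complex matrices. -/
abbrev MatTuple (d n : ℕ) := Fin d → Matrix (Fin n) (Fin n) ℂ

/-- The free matrix ball at level `n`: strict row contractions. -/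
def freeBall (d n : ℕ) : Set (MatTuple d n) :=
  {X | (1 - ∑ j, X j * (X j)ᴴ).PosDef}

/-- The direct sum of two tuples of matrices. -/
def dSum {d n m : ℕ} (X : MatTuple d n) (Y : MatTuple d m) : MatTuple d (n + m) :=
  fun j => Matrix.reindex finSumFinEquiv finSumFinEquiv (Matrix.fromBlocks (X j) 0 0 (Y j))

/-- An nc self-map of the free ball `𝔅_d`. -/
structure NCSelfMap (d : ℕ) where
  app : ∀ n, MatTuple d n → MatTuple d n
  mapsTo : ∀ n, Set.MapsTo (app n) (freeBall d n) (freeBall d n)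
  map_dSum : ∀ {n m : ℕ} (X : MatTuple d n) (Y : MatTuple d m),
    X ∈ freeBall d n → Y ∈ freeBall d m →
    app (n + m) (dSum X Y) = dSum (app n X) (app m Y)
  map_sim : ∀ {n : ℕ} (X : MatTuple d n) (S : Matrix (Fin n) (Fin n) ℂ),
    X ∈ freeBall d n → IsUnit S →
    (fun j => S⁻¹ * X j * S) ∈ freeBall d n →
    app n (fun j => S⁻¹ * X j * S) = fun j => S⁻¹ * app n X j * S
  holo : ∀ n, DifferentiableOn ℂ (app n) (freeBall d n)

/-- A tuple is generic if its coordinates generate the full matrix algebra. -/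
def IsGeneric {d n : ℕ} (X : MatTuple d n) : Prop :=
  Algebra.adjoin ℂ (Set.range X) = ⊤

/-- The homogeneous degree-one linear relations satisfied by the coordinates of `X`. -/
def linRel {d n : ℕ} (X : MatTuple d n) : Set (Fin d → ℂ) :=
  {α | ∑ j, α j • X j = 0}

/-- The scalar point of level `n` associated to a vector in `ℂ^d`. -/
def scalarPt (d n : ℕ) (v : Fin d → ℂ) : MatTuple d n :=
  fun j => v j • (1 : Matrix (Fin n) (Fin n) ℂ)

/-- The squared Euclidean norm of a complex vector. -/
noncomputable def normSqVec {ι : Type*} [Fintype ι] (v : ι → ℂ) : ℝ := ∑ i, ‖v i‖ ^ 2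

section NormSqVec

variable {ι κ : Type*} [Fintype ι] [Fintype κ]

lemma star_dotProduct_self_eq (v : ι → ℂ) : star v ⬝ᵥ v = (normSqVec v : ℂ) := by
  simp [dotProduct, normSqVec, Complex.conj_mul']

lemma normSqVec_eq_re (v : ι → ℂ) : normSqVec v = (star v ⬝ᵥ v).re := by
  rw [star_dotProduct_self_eq, Complex.ofReal_re]

lemma normSqVec_eq_norm_sq (v : ι → ℂ) : normSqVec v = ‖WithLp.toLp 2 v‖ ^ 2 := by
  rw [EuclideanSpace.norm_sq_eq]; rfl

lemma normSqVec_nonneg (v : ι → ℂ) : 0 ≤ normSqVec v :=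
  Finset.sum_nonneg fun _ _ => by positivity

@[simp] lemma normSqVec_zero : normSqVec (0 : ι → ℂ) = 0 := by simp [normSqVec]

lemma normSqVec_eq_zero {v : ι → ℂ} : normSqVec v = 0 ↔ v = 0 := by
  rw [normSqVec_eq_norm_sq]; simp

lemma normSqVec_pos {v : ι → ℂ} (hv : v ≠ 0) : 0 < normSqVec v :=
  (normSqVec_nonneg v).lt_of_ne fun h => hv (normSqVec_eq_zero.1 h.symm)

@[simp] lemma normSqVec_smul (c : ℂ) (v : ι → ℂ) :
    normSqVec (c • v) = ‖c‖ ^ 2 * normSqVec v := by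
  simp [normSqVec, Finset.mul_sum, mul_pow]

@[simp] lemma normSqVec_star (v : ι → ℂ) : normSqVec (star v) = normSqVec v := by
  simp [normSqVec]

@[simp] lemma normSqVec_elim (u : ι → ℂ) (v : κ → ℂ) :
    normSqVec (Sum.elim u v) = normSqVec u + normSqVec v := by
  simp [normSqVec]

lemma normSqVec_sub (u v : ι → ℂ) :
    normSqVec (u - v) = normSqVec u - 2 * (star v ⬝ᵥ u).re + normSqVec v := by
  have h : star u ⬝ᵥ v = star (star v ⬝ᵥ u) :=
    star_dotProduct u v
  have h' : (star u ⬝ᵥ v).re = (star v ⬝ᵥ u).re := by rw [h]; simp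
  simp only [normSqVec_eq_re, star_sub, sub_dotProduct, dotProduct_sub, Complex.sub_re]
  rw [h']; ring

lemma star_dotProduct_conjTranspose_mulVec (M : Matrix ι κ ℂ) (u : κ → ℂ) (v : ι → ℂ) :
    star u ⬝ᵥ (Mᴴ *ᵥ v) = star (M *ᵥ u) ⬝ᵥ v := by
  rw [star_mulVec, dotProduct_mulVec]

lemma two_mul_normSqVec_conjTranspose_mulVec_le (M : Matrix ι κ ℂ) (v : ι → ℂ) :
    2 * normSqVec (Mᴴ *ᵥ v) ≤ normSqVec v + normSqVec (M *ᵥ (Mᴴ *ᵥ v)) := by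
  have h0 := normSqVec_nonneg (v - M *ᵥ (Mᴴ *ᵥ v))
  have h1 : (star (M *ᵥ (Mᴴ *ᵥ v)) ⬝ᵥ v).re = normSqVec (Mᴴ *ᵥ v) := by
    rw [← star_dotProduct_conjTranspose_mulVec, normSqVec_eq_re]
  rw [normSqVec_sub, h1] at h0
  linarith

/-- If `M` is a contraction, so is its adjoint. -/
lemma normSqVec_conjTranspose_mulVec_le {M : Matrix ι κ ℂ}
    (h : ∀ v, normSqVec (M *ᵥ v) ≤ normSqVec v) (v : ι → ℂ) :
    normSqVec (Mᴴ *ᵥ v) ≤ normSqVec v := by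
  linarith [two_mul_normSqVec_conjTranspose_mulVec_le M v, h (Mᴴ *ᵥ v)]

/-- Fixed vectors of the adjoint of a contraction are fixed by the contraction. -/
lemma mulVec_eq_self_of_conjTranspose {M : Matrix ι ι ℂ}
    (h : ∀ v, normSqVec (M *ᵥ v) ≤ normSqVec v) {v : ι → ℂ} (hv : Mᴴ *ᵥ v = v) :
    M *ᵥ v = v := by
  have h1 : (star v ⬝ᵥ (M *ᵥ v)).re = normSqVec v := by
    rw [dotProduct_mulVec, ← conjTranspose_conjTranspose M, ← star_mulVec, hv, normSqVec_eq_re]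
  have h2 := normSqVec_sub (M *ᵥ v) v
  have h3 := normSqVec_nonneg (M *ᵥ v - v)
  have h4 := h v
  exact sub_eq_zero.1 (normSqVec_eq_zero.1 (by linarith))

/-- Matrices that strictly decrease the Euclidean norm. -/
def IsStrictContraction (M : Matrix ι κ ℂ) : Prop :=
  ∀ v, v ≠ 0 → normSqVec (M *ᵥ v) < normSqVec v

lemma IsStrictContraction.le {M : Matrix ι κ ℂ} (hM : IsStrictContraction M) (v : κ → ℂ) :
    normSqVec (M *ᵥ v) ≤ normSqVec v := by
  rcases eq_or_ne v 0 with rfl | hv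
  · simp
  · exact (hM v hv).le

lemma IsStrictContraction.conjTranspose {M : Matrix ι κ ℂ} (hM : IsStrictContraction M) :
    IsStrictContraction Mᴴ := by
  intro v hv
  rcases eq_or_ne (Mᴴ *ᵥ v) 0 with h | h
  · rw [h, normSqVec_zero]; exact normSqVec_pos hv
  · linarith [two_mul_normSqVec_conjTranspose_mulVec_le M v, hM _ h]

lemma isStrictContraction_conjTranspose {M : Matrix ι κ ℂ} :
    IsStrictContraction Mᴴ ↔ IsStrictContraction M :=
  ⟨fun h => by simpa using h.conjTranspose, fun h => h.conjTranspose⟩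

lemma posDef_one_sub_mul_conjTranspose_iff [DecidableEq ι] {M : Matrix ι κ ℂ} :
    (1 - M * Mᴴ).PosDef ↔ IsStrictContraction M := by
  rw [← isStrictContraction_conjTranspose, posDef_iff_dotProduct_mulVec]
  have key (v : ι → ℂ) : star v ⬝ᵥ ((1 - M * Mᴴ) *ᵥ v)
      = ((normSqVec v - normSqVec (Mᴴ *ᵥ v) : ℝ) : ℂ) := by
    rw [sub_mulVec, one_mulVec, dotProduct_sub, star_dotProduct_self_eq, ← mulVec_mulVec,
      dotProduct_mulVec, ← conjTranspose_conjTranspose M, ← star_mulVec, conjTranspose_conjTranspose,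
      star_dotProduct_self_eq]
    push_cast; rfl
  simp only [key, Complex.zero_lt_real, sub_pos]
  refine ⟨fun h v hv => h.2 hv, fun h => ⟨?_, fun v hv => h v hv⟩⟩
  exact isHermitian_one.sub (isHermitian_mul_conjTranspose_self M)

lemma IsStrictContraction.exists_lt_one {M : Matrix ι κ ℂ} (hM : IsStrictContraction M) :
    ∃ c : ℝ, 0 < c ∧ c < 1 ∧ ∀ v, normSqVec (M *ᵥ v) ≤ c * normSqVec v := by
  have hcont : Continuous fun v : EuclideanSpace ℂ κ => normSqVec (M *ᵥ v.ofLp) := by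
    unfold normSqVec mulVec dotProduct
    fun_prop
  obtain ⟨c, hc0, hc1, hc⟩ : ∃ c : ℝ, 0 < c ∧ c < 1 ∧ ∀ v ∈ Metric.sphere
      (0 : EuclideanSpace ℂ κ) 1, normSqVec (M *ᵥ v.ofLp) ≤ c := by
    rcases (Metric.sphere (0 : EuclideanSpace ℂ κ) 1).eq_empty_or_nonempty with he | hne
    · exact ⟨1 / 2, by norm_num, by norm_num, by simp [he]⟩
    · obtain ⟨u, hu, hmax⟩ := (isCompact_sphere (0 : EuclideanSpace ℂ κ) 1).exists_isMaxOn hne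
        hcont.continuousOn
      have hu1 : normSqVec u.ofLp = 1 := by
        rw [normSqVec_eq_norm_sq]; simp at hu; simp [hu]
      have hlt := hM u.ofLp (by intro h; rw [h] at hu1; simp at hu1)
      rw [hu1] at hlt
      refine ⟨max (1 / 2) (normSqVec (M *ᵥ u.ofLp)), by positivity,
        max_lt (by norm_num) hlt, fun v hv => le_max_of_le_right (hmax hv)⟩
  refine ⟨c, hc0, hc1, fun v => ?_⟩
  rcases eq_or_ne v 0 with rfl | hv
  · simp
  have hpos := normSqVec_pos hv
  set r : ℝ := ‖WithLp.toLp 2 v‖ with hr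
  have hsq : normSqVec v = r ^ 2 := normSqVec_eq_norm_sq v
  have hr0 : r ≠ 0 := by rintro h; rw [hsq, h] at hpos; norm_num at hpos
  have := hc (WithLp.toLp 2 (((r⁻¹ : ℝ) : ℂ) • v)) (by
    rw [mem_sphere_zero_iff_norm, WithLp.toLp_smul, norm_smul, ← hr, Complex.norm_real,
      Real.norm_of_nonneg (inv_nonneg.2 (norm_nonneg _)), inv_mul_cancel₀ hr0])
  simp only [mulVec_smul, normSqVec_smul, Complex.norm_real, Real.norm_eq_abs, sq_abs] at this
  rw [hsq]
  have h2 : 0 < r ^ 2 := by positivity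
  rwa [inv_pow, inv_mul_le_iff₀ h2, mul_comm] at this

end NormSqVec

section RowBall

/-- The row operator `[X₁ ⋯ X_d]` of a tuple. -/
def rowMatrix {d : ℕ} {ι : Type} (X : Fin d → Matrix ι ι ℂ) : Matrix ι (Fin d × ι) ℂ :=
  of fun i p => X p.1 i p.2

/-- The slice `C_j` of a matrix with columns indexed by `Fin d × ι`. -/
def colSlice {d : ℕ} {ι κ : Type} (C : Matrix κ (Fin d × ι) ℂ) (j : Fin d) : Matrix κ ι ℂ :=
  of fun k i => C k (j, i)

/-- The tuple with entries `[[0, C_j], [0, X_j]]`. -/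
def corner {d : ℕ} {ι κ : Type} (C : Matrix κ (Fin d × ι) ℂ) (X : Fin d → Matrix ι ι ℂ) :
    Fin d → Matrix (κ ⊕ ι) (κ ⊕ ι) ℂ :=
  fun j => fromBlocks 0 (colSlice C j) 0 (X j)

/-- The free matrix ball with matrices indexed by an arbitrary finite type. -/
def rowBall (d : ℕ) (ι : Type) [Fintype ι] : Set (Fin d → Matrix ι ι ℂ) :=
  {X | IsStrictContraction (rowMatrix X)}

lemma colSlice_injective {d : ℕ} {ι κ : Type} {C D : Matrix κ (Fin d × ι) ℂ}
    (h : ∀ j, colSlice C j = colSlice D j) : C = D := by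
  ext k ⟨j, i⟩
  exact congr_fun₂ (h j) k i

variable {d : ℕ} {ι κ : Type} [Fintype ι] [Fintype κ]

lemma colSlice_mul {μ : Type} (A : Matrix μ κ ℂ) (C : Matrix κ (Fin d × ι) ℂ) (j : Fin d) :
    colSlice (A * C) j = A * colSlice C j := by
  ext a b
  simp [colSlice, mul_apply]

lemma sum_mul_conjTranspose_eq (X : Fin d → Matrix ι ι ℂ) :
    ∑ j, X j * (X j)ᴴ = rowMatrix X * (rowMatrix X)ᴴ := by
  ext a b
  simp [Matrix.sum_apply, mul_apply, rowMatrix, Fintype.sum_prod_type]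

lemma mem_rowBall_iff_posDef [DecidableEq ι] {X : Fin d → Matrix ι ι ℂ} :
    X ∈ rowBall d ι ↔ (1 - ∑ j, X j * (X j)ᴴ).PosDef := by
  rw [sum_mul_conjTranspose_eq, posDef_one_sub_mul_conjTranspose_iff]; rfl

lemma mem_freeBall_iff {n : ℕ} {X : MatTuple d n} : X ∈ freeBall d n ↔ X ∈ rowBall d (Fin n) :=
  mem_rowBall_iff_posDef.symm

lemma submatrix_mem_rowBall {X : Fin d → Matrix ι ι ℂ} (hX : X ∈ rowBall d ι) (e : κ ≃ ι) :
    (fun j => (X j).submatrix e e) ∈ rowBall d κ := by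
  classical
  rw [mem_rowBall_iff_posDef] at hX ⊢
  convert hX.submatrix e.injective using 1
  ext a b
  simp [Matrix.sum_apply, conjTranspose_submatrix, submatrix_mul_equiv, one_apply]

lemma zero_mem_rowBall : (0 : Fin d → Matrix ι ι ℂ) ∈ rowBall d ι := by
  classical
  rw [mem_rowBall_iff_posDef]
  simpa using PosDef.one

lemma normSqVec_prod_sum (v : Fin d × (κ ⊕ ι) → ℂ) : normSqVec v =
    normSqVec (fun p : Fin d × κ => v (p.1, .inl p.2)) +
      normSqVec (fun p : Fin d × ι => v (p.1, .inr p.2)) := by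
  simp [normSqVec, Fintype.sum_prod_type, Finset.sum_add_distrib]

lemma corner_mem_rowBall_iff {C : Matrix κ (Fin d × ι) ℂ} {X : Fin d → Matrix ι ι ℂ} :
    corner C X ∈ rowBall d (κ ⊕ ι) ↔
      ∀ v, v ≠ 0 → normSqVec (C *ᵥ v) + normSqVec (rowMatrix X *ᵥ v) < normSqVec v := by
  have key (v : Fin d × (κ ⊕ ι) → ℂ) : rowMatrix (corner C X) *ᵥ v =
      Sum.elim (C *ᵥ fun p => v (p.1, .inr p.2)) (rowMatrix X *ᵥ fun p => v (p.1, .inr p.2)) := by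
    ext (a | a) <;>
      simp [rowMatrix, corner, colSlice, mulVec, dotProduct, Fintype.sum_prod_type]
  constructor
  · intro h v hv
    have := h (fun p => Sum.elim 0 (fun i => v (p.1, i)) p.2) (fun h0 => hv (by
      ext ⟨j, i⟩; simpa using congr_fun h0 (j, .inr i)))
    rw [key, normSqVec_prod_sum] at this
    simpa [← Pi.zero_def] using this
  · intro h v hv
    rw [key, normSqVec_elim]
    rcases eq_or_ne (fun p : Fin d × ι => v (p.1, .inr p.2)) 0 with h0 | h0
    · rw [h0]; simpa using normSqVec_pos hv
    · refine (h _ h0).trans_le ?_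
      rw [normSqVec_prod_sum]
      linarith [normSqVec_nonneg fun p : Fin d × κ => v (p.1, .inl p.2)]

lemma fromBlocks_mem_rowBall {X : Fin d → Matrix κ κ ℂ} {Y : Fin d → Matrix ι ι ℂ}
    (hX : X ∈ rowBall d κ) (hY : Y ∈ rowBall d ι) :
    (fun j => fromBlocks (X j) 0 0 (Y j)) ∈ rowBall d (κ ⊕ ι) := by
  intro v hv
  have key : rowMatrix (fun j => fromBlocks (X j) 0 0 (Y j)) *ᵥ v =
      Sum.elim (rowMatrix X *ᵥ fun p => v (p.1, .inl p.2))
        (rowMatrix Y *ᵥ fun p => v (p.1, .inr p.2)) := by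
    ext (a | a) <;> simp [rowMatrix, mulVec, dotProduct, Fintype.sum_prod_type]
  rw [key, normSqVec_elim, normSqVec_prod_sum v]
  rcases eq_or_ne (fun p : Fin d × κ => v (p.1, .inl p.2)) 0 with h1 | h1
  · refine add_lt_add_of_le_of_lt (hX.le _) (hY _ fun h2 => hv ?_)
    ext ⟨j, i | i⟩
    · exact congr_fun h1 (j, i)
    · exact congr_fun h2 (j, i)
  · exact add_lt_add_of_lt_of_le (hX _ h1) (hY.le _)

end RowBall

namespace NCSelfMap

variable {d : ℕ} (f : NCSelfMap d)

lemma reindex_conj {α β : Type*} [Fintype α] [Fintype β] [DecidableEq α] [DecidableEq β]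
    (e : α ≃ β) (A B C : Matrix α α ℂ) :
    reindex e e A * reindex e e B * reindex e e C = reindex e e (A * B * C) := by
  simp [submatrix_mul_equiv]

/-- An nc map respects intertwiners. -/
lemma app_mul_of_mul {n m : ℕ} {X : MatTuple d n} {Y : MatTuple d m} (hX : X ∈ freeBall d n)
    (hY : Y ∈ freeBall d m) (Γ : Matrix (Fin n) (Fin m) ℂ) (h : ∀ j, X j * Γ = Γ * Y j)
    (j : Fin d) : f.app n X j * Γ = Γ * f.app m Y j := by
  set e := finSumFinEquiv (m := n) (n := m)
  set S₀ : Matrix (Fin n ⊕ Fin m) (Fin n ⊕ Fin m) ℂ := fromBlocks 1 Γ 0 1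
  set S₁ : Matrix (Fin n ⊕ Fin m) (Fin n ⊕ Fin m) ℂ := fromBlocks 1 (-Γ) 0 1
  have hS : S₁ * S₀ = 1 := by simp [S₀, S₁, fromBlocks_multiply]
  have hS' : reindex e e S₁ * reindex e e S₀ = 1 := by
    simp only [reindex_apply, submatrix_mul_equiv, hS, submatrix_one_equiv]
  have hinv : (reindex e e S₀)⁻¹ = reindex e e S₁ := inv_eq_left_inv hS'
  have hsim : (fun j => (reindex e e S₀)⁻¹ * dSum X Y j * reindex e e S₀) = dSum X Y := by
    funext j
    rw [hinv, dSum, reindex_conj]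
    congr 1
    simp [S₀, S₁, fromBlocks_multiply, h]
  have hball : dSum X Y ∈ freeBall d (n + m) := by
    rw [mem_freeBall_iff] at *
    exact submatrix_mem_rowBall (fromBlocks_mem_rowBall hX hY) e.symm
  have := f.map_sim (dSum X Y) (reindex e e S₀) hball
    (IsUnit.of_mul_eq_one_right _ hS') (by rwa [hsim])
  rw [hsim, f.map_dSum X Y hX hY] at this
  have hj := congr_fun this j
  rw [hinv, dSum, reindex_conj, (reindex e e).injective.eq_iff] at hj
  simp only [S₀, S₁, fromBlocks_multiply, fromBlocks_inj] at hj
  have := hj.2.1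
  simp at this
  rw [eq_comm, add_neg_eq_zero] at this
  exact this

end NCSelfMap

section Ext

variable {d : ℕ} {ι κ μ : Type} [Fintype ι] [Fintype κ] [Fintype μ]

/-- The action of an nc map on tuples of matrices indexed by an arbitrary finite type. -/
noncomputable def NCSelfMap.ext (f : NCSelfMap d) (X : Fin d → Matrix ι ι ℂ) :
    Fin d → Matrix ι ι ℂ := fun j =>
  (f.app (Fintype.card ι) (fun j => (X j).submatrix (Fintype.equivFin ι).symm
    (Fintype.equivFin ι).symm) j).submatrix (Fintype.equivFin ι) (Fintype.equivFin ι)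

namespace NCSelfMap

variable (f : NCSelfMap d)

lemma ext_mem {X : Fin d → Matrix ι ι ℂ} (hX : X ∈ rowBall d ι) : f.ext X ∈ rowBall d ι :=
  submatrix_mem_rowBall (mem_freeBall_iff.1 (f.mapsTo _ (mem_freeBall_iff.2
    (submatrix_mem_rowBall hX (Fintype.equivFin ι).symm)))) (Fintype.equivFin ι)

lemma ext_mul_of_mul {X : Fin d → Matrix ι ι ℂ} {Y : Fin d → Matrix κ κ ℂ}
    (hX : X ∈ rowBall d ι) (hY : Y ∈ rowBall d κ) (Γ : Matrix ι κ ℂ)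
    (h : ∀ j, X j * Γ = Γ * Y j) (j : Fin d) : f.ext X j * Γ = Γ * f.ext Y j := by
  have := f.app_mul_of_mul
    (mem_freeBall_iff.2 (submatrix_mem_rowBall hX (Fintype.equivFin ι).symm))
    (mem_freeBall_iff.2 (submatrix_mem_rowBall hY (Fintype.equivFin κ).symm))
    (Γ.submatrix (Fintype.equivFin ι).symm (Fintype.equivFin κ).symm)
    (fun j => by simp only [submatrix_mul_equiv, h]) j
  have := congr_arg (fun M => M.submatrix (Fintype.equivFin ι) (Fintype.equivFin κ)) this
  simp only [← submatrix_mul_equiv _ _ _ (Fintype.equivFin ι) _,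
    ← submatrix_mul_equiv _ _ _ (Fintype.equivFin κ) _, submatrix_submatrix,
    Equiv.symm_comp_self, submatrix_id_id] at this
  exact this

lemma ext_eq_app {n : ℕ} {X : MatTuple d n} (hX : X ∈ freeBall d n) : f.ext X = f.app n X := by
  set e := Fintype.equivFin (Fin n)
  funext j
  have := f.app_mul_of_mul hX
    (mem_freeBall_iff.2 (submatrix_mem_rowBall (mem_freeBall_iff.1 hX) e.symm))
    ((1 : Matrix (Fin n) (Fin n) ℂ).submatrix id e.symm) (fun j => by
      ext a b
      simp [mul_apply, one_apply, Equiv.eq_symm_apply]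
      simp [← Equiv.eq_symm_apply]) j
  have := congr_arg (fun M => M.submatrix id e) this
  ext a b
  have := congr_fun₂ this a b
  simp [mul_apply, one_apply, Equiv.eq_symm_apply] at this
  exact this.symm

variable {f}

lemma ext_zero (h0 : f.app 1 0 = 0) : f.ext (0 : Fin d → Matrix ι ι ℂ) = 0 := by
  classical
  funext j
  ext a b
  have := f.ext_mul_of_mul (zero_mem_rowBall (ι := ι)) (zero_mem_rowBall (ι := Fin 1))
    (of fun i _ => if i = b then 1 else 0) (fun j => by simp) j
  rw [f.ext_eq_app (mem_freeBall_iff.2 zero_mem_rowBall), h0] at this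
  simpa [mul_apply] using congr_fun₂ this a 0

/-- The upper right corner of the value of `f` at `corner C X`. -/
noncomputable def topRight (f : NCSelfMap d) (C : Matrix κ (Fin d × ι) ℂ)
    (X : Fin d → Matrix ι ι ℂ) : Matrix κ (Fin d × ι) ℂ :=
  of fun k p => f.ext (corner C X) p.1 (.inl k) (.inr p.2)

lemma mem_rowBall_of_corner {C : Matrix κ (Fin d × ι) ℂ} {X : Fin d → Matrix ι ι ℂ}
    (h : corner C X ∈ rowBall d (κ ⊕ ι)) : X ∈ rowBall d ι := fun v hv => by
  linarith [corner_mem_rowBall_iff.1 h v hv, normSqVec_nonneg (C *ᵥ v)]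

lemma ext_corner (h0 : f.app 1 0 = 0) {C : Matrix κ (Fin d × ι) ℂ} {X : Fin d → Matrix ι ι ℂ}
    (h : corner C X ∈ rowBall d (κ ⊕ ι)) :
    f.ext (corner C X) = corner (f.topRight C X) (f.ext X) := by
  classical
  funext j
  have h1 := f.ext_mul_of_mul h (zero_mem_rowBall (ι := κ)) (fromRows 1 0) (fun j => by
    simp [corner, fromBlocks_mul_fromRows]) j
  have h2 := f.ext_mul_of_mul (mem_rowBall_of_corner h) h (fromCols 0 1) (fun j => by
    simp [corner, fromCols_mul_fromBlocks, mul_fromCols]) j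
  rw [ext_zero h0] at h1
  rw [← fromBlocks_toBlocks (f.ext (corner C X) j)] at h1 h2 ⊢
  simp only [fromBlocks_mul_fromRows, fromCols_mul_fromBlocks, mul_fromCols] at h1 h2
  simp only [corner, fromBlocks_inj]
  refine ⟨?_, rfl, ?_, ?_⟩
  · have := congr_arg toRows₁ h1
    simp at this
    exact this
  · have := congr_arg toCols₁ h2
    simpa using this.symm
  · have := congr_arg toCols₂ h2
    simpa using this.symm

lemma topRight_mul (h0 : f.app 1 0 = 0) {C : Matrix κ (Fin d × ι) ℂ} {A : Matrix μ κ ℂ}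
    {X : Fin d → Matrix ι ι ℂ} (h : corner C X ∈ rowBall d (κ ⊕ ι))
    (hA : corner (A * C) X ∈ rowBall d (μ ⊕ ι)) :
    f.topRight (A * C) X = A * f.topRight C X := by
  classical
  refine colSlice_injective fun j => ?_
  have := f.ext_mul_of_mul hA h (fromBlocks A 0 0 1) (fun j => by
    simp [corner, fromBlocks_multiply, colSlice_mul]) j
  rw [ext_corner h0 h, ext_corner h0 hA] at this
  simp only [corner, fromBlocks_multiply, fromBlocks_inj] at this
  simpa [colSlice_mul] using this.2.1

lemma topRight_smul_rowMatrix (h0 : f.app 1 0 = 0) {ε : ℂ} {X : Fin d → Matrix ι ι ℂ}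
    (h : corner (ε • rowMatrix X) X ∈ rowBall d (ι ⊕ ι)) :
    f.topRight (ε • rowMatrix X) X = ε • rowMatrix (f.ext X) := by
  classical
  refine colSlice_injective fun j => ?_
  have := f.ext_mul_of_mul h (mem_rowBall_of_corner h) (fromRows (ε • 1) 1) (fun j => by
    simp only [corner, fromBlocks_mul_fromRows, fromRows_mul]
    congr 1
    · ext a b; simp [colSlice, rowMatrix]
    · simp) j
  rw [ext_corner h0 h] at this
  simp only [corner, fromBlocks_mul_fromRows, fromRows_mul] at this
  have := congr_arg toRows₁ this
  simp only [toRows₁_fromRows, zero_mul, zero_add, Matrix.mul_one, smul_mul, Matrix.one_mul] at this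
  rw [this]; rfl

end NCSelfMap

end Ext

section Symbol

variable {d : ℕ} {ι κ : Type} [Fintype ι] [Fintype κ] [DecidableEq ι]

open scoped MatrixOrder in
lemma _root_.Matrix.PosSemidef.exists_eq_conjTranspose_mul_self {M : Matrix ι ι ℂ}
    (hM : M.PosSemidef) : ∃ B : Matrix ι ι ℂ, M = Bᴴ * B :=
  CStarAlgebra.nonneg_iff_eq_star_mul_self.1 hM.nonneg

namespace NCSelfMap

variable {f : NCSelfMap d}

/-- The matrix `H(X)` representing the difference-differential of `f` at `(0, X)`, so that
`f(X) = X H(X)` for the row operator of `X`; it does not depend on the scaling parameter `ε`. -/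
noncomputable def symbol (f : NCSelfMap d) (ε : ℂ) (X : Fin d → Matrix ι ι ℂ) :
    Matrix (Fin d × ι) (Fin d × ι) ℂ :=
  ε⁻¹ • f.topRight (ε • 1) X

lemma smul_one_corner_mem_iff {ε : ℂ} {X : Fin d → Matrix ι ι ℂ} :
    corner (ε • (1 : Matrix (Fin d × ι) (Fin d × ι) ℂ)) X ∈ rowBall d (Fin d × ι ⊕ ι) ↔
      ∀ v, v ≠ 0 → ‖ε‖ ^ 2 * normSqVec v + normSqVec (rowMatrix X *ᵥ v) < normSqVec v := by
  rw [corner_mem_rowBall_iff]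
  simp [smul_mulVec]

lemma topRight_eq_mul_symbol (h0 : f.app 1 0 = 0) {ε : ℂ} (hε : ε ≠ 0)
    {C : Matrix κ (Fin d × ι) ℂ} {X : Fin d → Matrix ι ι ℂ}
    (h : corner (ε • (1 : Matrix (Fin d × ι) (Fin d × ι) ℂ)) X ∈ rowBall d _)
    (hC : corner C X ∈ rowBall d (κ ⊕ ι)) : f.topRight C X = C * f.symbol ε X := by
  have hC' : C = (ε⁻¹ • C) * (ε • (1 : Matrix (Fin d × ι) (Fin d × ι) ℂ)) := by
    simp [smul_smul, hε]
  rw [hC'] at hC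
  conv_lhs => rw [hC']
  rw [topRight_mul h0 h hC, symbol]
  simp

lemma symbol_eq_symbol (h0 : f.app 1 0 = 0) {ε δ : ℂ} (hε : ε ≠ 0) (hδ : δ ≠ 0)
    {X : Fin d → Matrix ι ι ℂ}
    (h : corner (ε • (1 : Matrix (Fin d × ι) (Fin d × ι) ℂ)) X ∈ rowBall d _)
    (h' : corner (δ • (1 : Matrix (Fin d × ι) (Fin d × ι) ℂ)) X ∈ rowBall d _) :
    f.symbol δ X = f.symbol ε X := by
  rw [symbol, topRight_eq_mul_symbol h0 hε h h']
  simp [smul_smul, hδ]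

lemma rowMatrix_mul_symbol (h0 : f.app 1 0 = 0) {ε : ℂ} (hε : ε ≠ 0)
    {X : Fin d → Matrix ι ι ℂ}
    (h : corner (ε • (1 : Matrix (Fin d × ι) (Fin d × ι) ℂ)) X ∈ rowBall d _) :
    rowMatrix X * f.symbol ε X = rowMatrix (f.ext X) := by
  have h' : corner (ε • rowMatrix X) X ∈ rowBall d (ι ⊕ ι) := by
    rw [smul_one_corner_mem_iff] at h
    rw [corner_mem_rowBall_iff]
    intro v hv
    refine lt_of_le_of_lt ?_ (h v hv)
    have : normSqVec (rowMatrix X *ᵥ v) ≤ normSqVec v := by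
      nlinarith [h v hv, normSqVec_nonneg v, sq_nonneg ‖ε‖]
    rw [smul_mulVec, normSqVec_smul]
    gcongr
  have := topRight_smul_rowMatrix h0 h'
  rw [topRight_eq_mul_symbol h0 hε h h', smul_mul] at this
  exact smul_right_injective _ hε this

/-- The symbol of an nc self-map of the ball is contractive. -/
lemma normSqVec_symbol_mulVec_le (h0 : f.app 1 0 = 0) {ε : ℂ} (hε : ε ≠ 0)
    {X : Fin d → Matrix ι ι ℂ}
    (h : corner (ε • (1 : Matrix (Fin d × ι) (Fin d × ι) ℂ)) X ∈ rowBall d _)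
    (v : Fin d × ι → ℂ) : normSqVec (f.symbol ε X *ᵥ v) ≤ normSqVec v := by
  rcases eq_or_ne v 0 with rfl | hv
  · simp
  have hX : IsStrictContraction (rowMatrix X) := mem_rowBall_of_corner h
  have hpd : (1 - (rowMatrix X)ᴴ * (rowMatrix X)).PosSemidef := by
    have := (posDef_one_sub_mul_conjTranspose_iff.2 hX.conjTranspose).posSemidef
    rwa [conjTranspose_conjTranspose] at this
  obtain ⟨B, hB⟩ := hpd.exists_eq_conjTranspose_mul_self
  have hBv (u : Fin d × ι → ℂ) :
      normSqVec (B *ᵥ u) = normSqVec u - normSqVec (rowMatrix X *ᵥ u) := by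
    have h1 : star u ⬝ᵥ ((1 - (rowMatrix X)ᴴ * rowMatrix X) *ᵥ u) =
      star u ⬝ᵥ ((Bᴴ * B) *ᵥ u) := by rw [hB]
    rw [sub_mulVec, one_mulVec, dotProduct_sub, ← mulVec_mulVec, ← mulVec_mulVec,
      star_dotProduct_conjTranspose_mulVec, star_dotProduct_conjTranspose_mulVec] at h1
    simp only [star_dotProduct_self_eq] at h1
    exact_mod_cast h1.symm
  have hr : ∀ r ∈ Set.Ioo (0 : ℝ) 1, r * normSqVec (f.symbol ε X *ᵥ v) ≤ normSqVec v := by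
    intro r hr
    have hs : ‖((√r : ℝ) : ℂ)‖ ^ 2 = r := by
      rw [Complex.norm_real, Real.norm_eq_abs, sq_abs, Real.sq_sqrt hr.1.le]
    have hC : corner (((√r : ℝ) : ℂ) • B) X ∈ rowBall d _ := by
      rw [corner_mem_rowBall_iff]
      intro u hu
      rw [smul_mulVec, normSqVec_smul, hs, hBv]
      nlinarith [hX u hu, hr.2]
    have hmem := f.ext_mem hC
    rw [ext_corner h0 hC, topRight_eq_mul_symbol h0 hε h hC] at hmem
    have := corner_mem_rowBall_iff.1 hmem v hv
    rw [← rowMatrix_mul_symbol h0 hε h, smul_mul, smul_mulVec, normSqVec_smul, hs,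
      ← mulVec_mulVec, ← mulVec_mulVec, hBv] at this
    nlinarith [normSqVec_nonneg (rowMatrix X *ᵥ (f.symbol ε X *ᵥ v)), hr.2]
  by_contra! hlt
  have hpos := normSqVec_pos hv
  obtain ⟨r, hr1, hr2⟩ := exists_between ((div_lt_one (hpos.trans hlt)).2 hlt)
  have := hr r ⟨(div_pos hpos (hpos.trans hlt)).trans hr1, hr2⟩
  rw [div_lt_iff₀ (hpos.trans hlt)] at hr1
  linarith

/-- At the origin the symbol at any level is an ampliation of the symbol at level one. -/
lemma symbol_zero_apply (h0 : f.app 1 0 = 0) {ε : ℂ}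
    (h : corner (ε • (1 : Matrix (Fin d × ι) (Fin d × ι) ℂ)) 0 ∈ rowBall d _)
    (h' : corner (ε • (1 : Matrix (Fin d × Fin 1) (Fin d × Fin 1) ℂ)) 0 ∈ rowBall d _)
    (i j : Fin d) (k l : ι) :
    f.symbol ε (0 : Fin d → Matrix ι ι ℂ) (i, k) (j, l) =
      if l = k then f.symbol ε (0 : Fin d → Matrix (Fin 1) (Fin 1) ℂ) (i, 0) (j, 0) else 0 := by
  have := f.ext_mul_of_mul h' h (fromBlocks
    (of fun p q => if q = (p.1, k) then 1 else 0) 0 0 (of fun _ l => if l = k then 1 else 0))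
    (fun j => by
      simp only [corner, fromBlocks_multiply]
      congr 1
      · simp
      · ext a b
        obtain ⟨i, z⟩ := a
        simp only [colSlice, Matrix.zero_mul, Matrix.mul_zero, zero_add, add_zero, mul_apply,
          of_apply, Matrix.smul_apply, one_apply]
        rw [Fintype.sum_eq_single (j, b) fun q hq => by simp [hq]]
        simp [Prod.ext_iff, Subsingleton.elim z 0, and_comm, ite_and, eq_comm]
      · simp
      · simp) j
  rw [ext_corner h0 h, ext_corner h0 h'] at this
  simp only [corner, fromBlocks_multiply, fromBlocks_inj] at this
  have := congr_fun₂ this.2.1 (i, 0) l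
  simp [mul_apply, colSlice] at this
  simp only [symbol, Matrix.smul_apply]
  rw [← this]
  split_ifs <;> simp

lemma differentiableOn_ext_corner (f : NCSelfMap d) (C : Matrix κ (Fin d × ι) ℂ)
    (X : Fin d → Matrix ι ι ℂ) {U : Set ℂ} (hU : ∀ t ∈ U, corner C (t • X) ∈ rowBall d (κ ⊕ ι))
    (j : Fin d) (a b : κ ⊕ ι) :
    DifferentiableOn ℂ (fun t : ℂ => f.ext (corner C (t • X)) j a b) U := by
  set e := Fintype.equivFin (κ ⊕ ι)
  have hA : Differentiable ℂ (fun (t : ℂ) j => (corner C (t • X) j).submatrix e.symm e.symm) := by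
    refine differentiable_pi.2 fun j => differentiable_pi.2 fun a => differentiable_pi.2 fun b => ?_
    simp only [submatrix_apply]
    rcases e.symm a with a | a <;> rcases e.symm b with b | b <;>
      simp [corner] 
  have := (f.holo _).comp (hA.differentiableOn (s := U)) (fun t ht => mem_freeBall_iff.2
    (submatrix_mem_rowBall (hU t ht) e.symm))
  have := differentiableOn_pi.1 this j
  have := differentiableOn_pi.1 this (e a)
  exact differentiableOn_pi.1 this (e b)

end NCSelfMap

end Symbol

section FixedVectors

variable {d : ℕ} {ι : Type} [Fintype ι] [DecidableEq ι]

namespace NCSelfMap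

variable {f : NCSelfMap d}

lemma smul_one_corner_mono {ε : ℂ} {X : Fin d → Matrix ι ι ℂ} {c : ℝ}
    (hc : ∀ v, normSqVec (rowMatrix X *ᵥ v) ≤ c * normSqVec v) {t : ℂ}
    (h : ‖ε‖ ^ 2 + ‖t‖ ^ 2 * c < 1) :
    corner (ε • (1 : Matrix (Fin d × ι) (Fin d × ι) ℂ)) (t • X) ∈ rowBall d (Fin d × ι ⊕ ι) := by
  rw [smul_one_corner_mem_iff]
  intro v hv
  have : rowMatrix (t • X) = t • rowMatrix X := by ext; simp [rowMatrix]
  rw [this, smul_mulVec, normSqVec_smul]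
  have h1 := mul_le_mul_of_nonneg_left (hc v) (sq_nonneg ‖t‖)
  nlinarith [normSqVec_pos hv]

lemma differentiableOn_symbol_mulVec (f : NCSelfMap d) (ε : ℂ) (X : Fin d → Matrix ι ι ℂ)
    {U : Set ℂ} (hU : ∀ t ∈ U, corner (ε • (1 : Matrix (Fin d × ι) (Fin d × ι) ℂ)) (t • X) ∈
      rowBall d (Fin d × ι ⊕ ι)) (w : Fin d × ι → ℂ) :
    DifferentiableOn ℂ (fun t : ℂ => WithLp.toLp 2 (f.symbol ε (t • X) *ᵥ w)) U := by
  rw [differentiableOn_euclidean]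
  intro p
  simp only [mulVec, dotProduct, symbol, Matrix.smul_apply, smul_eq_mul, topRight, of_apply]
  refine DifferentiableOn.fun_sum fun q _ => ?_
  exact ((f.differentiableOn_ext_corner _ X hU _ _ _).const_mul _).mul_const _

/-- A vector fixed by the symbol at one point of a disc through the origin is fixed by it at all
points of the disc. -/
lemma symbol_mulVec_eq_self_of_eq (h0 : f.app 1 0 = 0) {ε : ℂ} (hε : ε ≠ 0)
    {X : Fin d → Matrix ι ι ℂ} {R : ℝ} (hR : ∀ t ∈ Metric.ball (0 : ℂ) R,
      corner (ε • (1 : Matrix (Fin d × ι) (Fin d × ι) ℂ)) (t • X) ∈ rowBall d (Fin d × ι ⊕ ι))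
    {s t : ℂ} (hs : s ∈ Metric.ball (0 : ℂ) R) (ht : t ∈ Metric.ball (0 : ℂ) R)
    {w : Fin d × ι → ℂ} (hw : f.symbol ε (s • X) *ᵥ w = w) : f.symbol ε (t • X) *ᵥ w = w := by
  have hmax : IsMaxOn (norm ∘ fun t : ℂ => WithLp.toLp 2 (f.symbol ε (t • X) *ᵥ w))
      (Metric.ball 0 R) s := fun t ht => by
    have := normSqVec_symbol_mulVec_le h0 hε (hR t ht) w
    rw [normSqVec_eq_norm_sq, normSqVec_eq_norm_sq] at this
    simpa [hw] using (sq_le_sq₀ (norm_nonneg _) (norm_nonneg _)).1 this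
  have := Complex.eqOn_of_isPreconnected_of_isMaxOn_norm (convex_ball 0 R).isPreconnected
    Metric.isOpen_ball (differentiableOn_symbol_mulVec f ε X hR w) hs hmax ht
  simp only [Function.const_apply, hw] at this
  exact WithLp.toLp_injective 2 this

lemma exists_symbol_mulVec_eq_self_iff (h0 : f.app 1 0 = 0) {X : Fin d → Matrix ι ι ℂ}
    (hX : X ∈ rowBall d ι) : ∃ ε : ℂ, ε ≠ 0 ∧ ‖ε‖ < 1 ∧
      corner (ε • (1 : Matrix (Fin d × ι) (Fin d × ι) ℂ)) X ∈ rowBall d _ ∧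
      ∀ w, f.symbol ε X *ᵥ w = w ↔ f.symbol ε 0 *ᵥ w = w := by
  obtain ⟨c, hc0, hc1, hc⟩ := IsStrictContraction.exists_lt_one hX
  set ε : ℂ := ((√((1 - c) / 4) : ℝ) : ℂ) with hεdef
  have hε2 : ‖ε‖ ^ 2 = (1 - c) / 4 := by
    rw [hεdef, Complex.norm_real, Real.norm_eq_abs, sq_abs, Real.sq_sqrt (by linarith)]
  have hε : ε ≠ 0 := by
    intro h
    rw [h] at hε2
    simp at hε2
    linarith
  have hR : ∀ t ∈ Metric.ball (0 : ℂ) √(1 + (1 - c) / 2),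
      corner (ε • (1 : Matrix (Fin d × ι) (Fin d × ι) ℂ)) (t • X) ∈
        rowBall d (Fin d × ι ⊕ ι) := by
    intro t ht
    refine smul_one_corner_mono hc ?_
    rw [mem_ball_zero_iff, Real.lt_sqrt (norm_nonneg _)] at ht
    rw [hε2]
    nlinarith
  have m1 : (1 : ℂ) ∈ Metric.ball (0 : ℂ) √(1 + (1 - c) / 2) := by
    rw [mem_ball_zero_iff, Real.lt_sqrt (norm_nonneg _), norm_one]
    linarith
  have m0 : (0 : ℂ) ∈ Metric.ball (0 : ℂ) √(1 + (1 - c) / 2) :=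
    Metric.mem_ball_self (Real.sqrt_pos.2 (by linarith))
  refine ⟨ε, hε, ?_, by simpa using hR 1 m1, fun w => ⟨fun h => ?_, fun h => ?_⟩⟩
  · nlinarith [norm_nonneg ε]
  · simpa using symbol_mulVec_eq_self_of_eq h0 hε hR m1 m0 (w := w) (by simpa using h)
  · simpa using symbol_mulVec_eq_self_of_eq h0 hε hR m0 m1 (w := w) (by simpa using h)

lemma corner_zero_mem {ε : ℂ} (h : ‖ε‖ < 1) :
    corner (ε • (1 : Matrix (Fin d × ι) (Fin d × ι) ℂ)) 0 ∈ rowBall d (Fin d × ι ⊕ ι) := by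
  simpa using smul_one_corner_mono (X := (0 : Fin d → Matrix ι ι ℂ)) (c := 0) (t := 0) (ε := ε)
    (fun v => by
      have : rowMatrix (0 : Fin d → Matrix ι ι ℂ) = 0 := by ext; simp [rowMatrix]
      simp [this]) (by simpa using h)

/-- Fixed vectors of the symbol at the origin give rise to fixed points at level one. -/
lemma exists_fixed_of_symbol_zero (h0 : f.app 1 0 = 0) {ε : ℂ} (hε : ε ≠ 0) (hε1 : ‖ε‖ < 1)
    {u : Fin d × Fin 1 → ℂ}
    (hu : f.symbol ε (0 : Fin d → Matrix (Fin 1) (Fin 1) ℂ) *ᵥ u = u) :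
    ∃ η : ℂ, η ≠ 0 ∧ ∃ X ∈ freeBall d 1, f.app 1 X = X ∧
      ∀ j, X j 0 0 = η * star (u (j, 0)) := by
  set n := normSqVec u
  have hn : 0 ≤ n := normSqVec_nonneg u
  set η : ℂ := (((1 + n)⁻¹ : ℝ) : ℂ) with hη
  have hη0 : η ≠ 0 := by rw [hη]; exact_mod_cast (by positivity : (1 + n)⁻¹ ≠ 0)
  set X : MatTuple d 1 := fun j => of fun _ _ => η * star (u (j, 0))
  have hrow : (rowMatrix X)ᴴ = of fun p _ => η * u p := by
    ext ⟨p, i⟩ q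
    simp [rowMatrix, X, η, Subsingleton.elim i 0]
  have hX : X ∈ rowBall d (Fin 1) := by
    refine isStrictContraction_conjTranspose.1 fun v hv => ?_
    have h1 : (rowMatrix X)ᴴ *ᵥ v = (v 0 * η) • u := by
      rw [hrow]
      ext p
      simp [mulVec, dotProduct]
      ring
    have h2 : normSqVec v = ‖v 0‖ ^ 2 := by simp [normSqVec]
    have h3 := normSqVec_pos hv
    have h4 : ‖η‖ = (1 + n)⁻¹ := by
      rw [hη, Complex.norm_real, Real.norm_of_nonneg (by positivity)]
    have h5 : (1 + n)⁻¹ ^ 2 * n < 1 := by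
      rw [inv_pow, inv_mul_lt_iff₀ (by positivity)]
      nlinarith
    rw [h1, normSqVec_smul, norm_mul, mul_pow, ← h2, h4, mul_assoc]
    exact mul_lt_of_lt_one_right h3 h5
  obtain ⟨δ, hδ, hδ1, hδX, hiff⟩ := exists_symbol_mulVec_eq_self_iff h0 hX
  have hsym := symbol_eq_symbol h0 hε hδ (X := (0 : Fin d → Matrix (Fin 1) (Fin 1) ℂ))
    (corner_zero_mem hε1) (corner_zero_mem hδ1)
  have hfix : f.symbol δ X *ᵥ u = u := (hiff u).2 (by rw [hsym, hu])
  have hfix' : (f.symbol δ X)ᴴ *ᵥ u = u :=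
    mulVec_eq_self_of_conjTranspose
      (normSqVec_conjTranspose_mulVec_le (normSqVec_symbol_mulVec_le h0 hδ hδX))
      (by rwa [conjTranspose_conjTranspose])
  have hmul : rowMatrix X * f.symbol δ X = rowMatrix X := by
    apply conjTranspose_injective
    rw [conjTranspose_mul, hrow]
    ext p q
    have := congr_fun hfix' p
    simp only [mulVec, dotProduct] at this
    simp only [mul_apply, of_apply]
    rw [← this, Finset.mul_sum]
    exact Finset.sum_congr rfl fun _ _ => by ring
  rw [rowMatrix_mul_symbol h0 hδ hδX] at hmul
  refine ⟨η, hη0, X, mem_freeBall_iff.2 hX, ?_, fun j => rfl⟩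
  rw [← f.ext_eq_app (mem_freeBall_iff.2 hX)]
  funext j
  ext a b
  exact congr_fun₂ hmul a (j, b)

/-- If all fixed points at level one are supported on a set of coordinates, then so are the fixed
points at every level. -/
lemma apply_eq_zero_of_fixed (h0 : f.app 1 0 = 0) {j : Fin d}
    (hfix : ∀ v ∈ freeBall d 1, f.app 1 v = v → v j = 0) {n : ℕ} {X : MatTuple d n}
    (hX : X ∈ freeBall d n) (hfX : f.app n X = X) : X j = 0 := by
  have hX' := mem_freeBall_iff.1 hX
  obtain ⟨ε, hε, hε1, hεX, hiff⟩ := exists_symbol_mulVec_eq_self_iff (f := f) h0 hX'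
  have hmul : rowMatrix X * f.symbol ε X = rowMatrix X := by
    rw [rowMatrix_mul_symbol h0 hε hεX, f.ext_eq_app hX, hfX]
  ext a b
  set w : Fin d × Fin n → ℂ := fun p => star (rowMatrix X a p) with hw
  have h1 : (f.symbol ε X)ᴴ *ᵥ w = w := by
    have := congr_arg conjTranspose hmul
    rw [conjTranspose_mul] at this
    ext p
    simpa [mul_apply, mulVec, dotProduct, w] using congr_fun₂ this p a
  have h2 := (hiff w).1 (mulVec_eq_self_of_conjTranspose
    (normSqVec_symbol_mulVec_le h0 hε hεX) h1)
  have h3 : f.symbol ε (0 : Fin d → Matrix (Fin 1) (Fin 1) ℂ) *ᵥ (fun p => w (p.1, b)) =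
      fun p => w (p.1, b) := by
    ext ⟨i, k⟩
    obtain rfl : k = 0 := Subsingleton.elim _ _
    have := congr_fun h2 (i, b)
    simp only [mulVec, dotProduct, Fintype.sum_prod_type,
      symbol_zero_apply (ι := Fin n) h0 (corner_zero_mem hε1) (corner_zero_mem hε1)] at this
    simpa [mulVec, dotProduct, Fintype.sum_prod_type] using this
  obtain ⟨η, hη, Y, hY, hfY, hYe⟩ := exists_fixed_of_symbol_zero h0 hε hε1 h3
  have := hYe j
  rw [hfix Y hY hfY] at this
  simpa [hη, w, rowMatrix] using this

end NCSelfMap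

end FixedVectors

/-- if the level-1 fixed point set of an nc self-map (`d ≥ 2`) is exactly
the disc `{(z,0,…,0) : |z| < 1}`, then every fixed point at level 2 is supported on the
first coordinate. -/
theorem stmt_19 {d : ℕ} (hd : 2 ≤ d) (f : NCSelfMap d)
    (hfix1 : ∀ v ∈ freeBall d 1, (f.app 1 v = v ↔ ∀ j : Fin d, 1 ≤ (j : ℕ) → v j = 0)) :
    ∀ X ∈ freeBall d 2, f.app 2 X = X → ∀ j : Fin d, 1 ≤ (j : ℕ) → X j = 0 := by
  have zero_mem : (0 : MatTuple d 1) ∈ freeBall d 1 := mem_freeBall_iff.2 zero_mem_rowBall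
  intro X hX hfX j hj
  exact NCSelfMap.apply_eq_zero_of_fixed ((hfix1 0 zero_mem).2 fun _ _ => rfl)
    (fun v hv hfv => (hfix1 v hv).1 hfv j hj) hX hfX
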